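/- arXiv:1806.08929 — 7 statements merged into one kernel-verified Lean document; each statement's English description precedes it below -/
import Mathlib

section
/- The series product of SLH models is associative: for any three models G₁ = (S₁, L₁, H₁), G₂ = (S₂, L₂, H₂), G₃ = (S₃, L₃, H₃) with the same system Hilbert space 𝔥 and the same multiplicity n, one has (G₃ ◁ G₂) ◁ G₁ = G₃ ◁ (G₂ ◁ G₁), i.e. the scattering, coupling and Hamiltonian components of the two iterated products coincide. -/
/-!
STATEMENT 0: Associativity of the series product of SLH models.
-/

open Complex

/-- An SLH model: an `n × n` matrix of bounded operators (scattering), an `n`-tuple of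
bounded operators (coupling), and a bounded operator (Hamiltonian). -/
structure SLH (𝔥 : Type*) [NormedAddCommGroup 𝔥] [InnerProductSpace ℂ 𝔥] [CompleteSpace 𝔥]
    (n : ℕ) where
  S : Matrix (Fin n) (Fin n) (𝔥 →L[ℂ] 𝔥)
  L : Fin n → 𝔥 →L[ℂ] 𝔥
  H : 𝔥 →L[ℂ] 𝔥

namespace SLH

variable {𝔥 : Type*} [NormedAddCommGroup 𝔥] [InnerProductSpace ℂ 𝔥] [CompleteSpace 𝔥] {n : ℕ}

/-- `Im{A} = (A - A*)/(2i)`. -/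
noncomputable def opIm (A : 𝔥 →L[ℂ] 𝔥) : 𝔥 →L[ℂ] 𝔥 :=
  (2 * Complex.I)⁻¹ • (A - star A)

/-- `S` is unitary as an operator on `𝔥ⁿ`. -/
def IsUnitaryMatrix (S : Matrix (Fin n) (Fin n) (𝔥 →L[ℂ] 𝔥)) : Prop :=
  (∀ i j, ∑ k, star (S k i) * S k j = if i = j then 1 else 0) ∧
  (∀ i j, ∑ k, S i k * star (S j k) = if i = j then 1 else 0)

/-- A genuine SLH model has a unitary scattering matrix and a self-adjoint Hamiltonian. -/
def IsModel (G : SLH 𝔥 n) : Prop :=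
  IsUnitaryMatrix G.S ∧ IsSelfAdjoint G.H

/-- The series product `G₂ ◁ G₁ = (S₂S₁, L₂ + S₂L₁, H₁ + H₂ + Im{Σ L₂ᵢ* S₂ᵢⱼ L₁ⱼ})`. -/
noncomputable def series (G₂ G₁ : SLH 𝔥 n) : SLH 𝔥 n where
  S := G₂.S * G₁.S
  L := fun i => G₂.L i + ∑ j, G₂.S i j * G₁.L j
  H := G₁.H + G₂.H + opIm (∑ i, ∑ j, star (G₂.L i) * (G₂.S i j * G₁.L j))

end SLH

open Matrix in
/-- An isometric matrix over a star ring preserves the pairing `star v ⬝ᵥ w`. -/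
lemma Matrix.star_mulVec_dotProduct_mulVec {A m n : Type*} [Fintype m] [Fintype n] [DecidableEq n]
    [Semiring A] [StarRing A] {S : Matrix m n A} (hS : Sᴴ * S = 1) (v w : n → A) :
    star (S *ᵥ v) ⬝ᵥ (S *ᵥ w) = star v ⬝ᵥ w := by
  rw [star_mulVec, dotProduct_mulVec, vecMul_vecMul, hS, vecMul_one]

namespace SLH

open Matrix

variable {𝔥 : Type*} [NormedAddCommGroup 𝔥] [InnerProductSpace ℂ 𝔥] [CompleteSpace 𝔥] {n : ℕ}

lemma opIm_add (A B : 𝔥 →L[ℂ] 𝔥) : opIm (A + B) = opIm A + opIm B := by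
  simp only [opIm, star_add, ← smul_add, add_sub_add_comm]

lemma IsUnitaryMatrix.conjTranspose_mul_self {S : Matrix (Fin n) (Fin n) (𝔥 →L[ℂ] 𝔥)}
    (hS : IsUnitaryMatrix S) : Sᴴ * S = 1 := by
  ext1 i j
  simpa [mul_apply, one_apply] using hS.1 i j

lemma series_eq (G₂ G₁ : SLH 𝔥 n) :
    series G₂ G₁ = ⟨G₂.S * G₁.S, G₂.L + G₂.S *ᵥ G₁.L,
      G₁.H + G₂.H + opIm (star G₂.L ⬝ᵥ G₂.S *ᵥ G₁.L)⟩ := by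
  simp only [series, dotProduct, mulVec, Finset.mul_sum, Pi.star_apply]
  rfl

end SLH

/-- The series product of SLH models is associative. -/
theorem series_product_assoc {𝔥 : Type*} [NormedAddCommGroup 𝔥] [InnerProductSpace ℂ 𝔥]
    [CompleteSpace 𝔥] {n : ℕ} (G₁ G₂ G₃ : SLH 𝔥 n)
    (h₁ : G₁.IsModel) (h₂ : G₂.IsModel) (h₃ : G₃.IsModel) :
    SLH.series (SLH.series G₃ G₂) G₁ = SLH.series G₃ (SLH.series G₂ G₁) := by
  simp only [SLH.series_eq, Matrix.mulVec_add, Matrix.mulVec_mulVec, Matrix.mul_assoc,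
    star_add, add_dotProduct, dotProduct_add, SLH.opIm_add]
  rw [← Matrix.mulVec_mulVec G₁.L G₃.S G₂.S,
    Matrix.star_mulVec_dotProduct_mulVec h₃.1.conjTranspose_mul_self]
  congr 1 <;> abel
end

section
/- Every SLH model G = (S, L, H) has a two-sided series-product inverse given by G⁻¹ := (S*, −S*L, −H): both G⁻¹ ◁ G and G ◁ G⁻¹ equal the identity model E = (I, 0, 0). (Here S* denotes the adjoint matrix (S*)_{ij} = S_{ji}*, and (S*L)ᵢ = Σ_j S_{ji}* L_j.) -/
/-!
STATEMENT 2: Every SLH model `G = (S, L, H)` has the two-sided series-product inverse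
`G⁻¹ = (S*, −S*L, −H)`.
-/

open Complex

namespace SLH

variable {𝔥 : Type*} [NormedAddCommGroup 𝔥] [InnerProductSpace ℂ 𝔥] [CompleteSpace 𝔥] {n : ℕ}

/-- The trivial model `E = (I, 0, 0)`. -/
def trivialModel (𝔥 : Type*) [NormedAddCommGroup 𝔥] [InnerProductSpace ℂ 𝔥] [CompleteSpace 𝔥]
    (n : ℕ) : SLH 𝔥 n where
  S := 1
  L := fun _ => 0
  H := 0

/-- The series-product inverse `G⁻¹ = (S*, −S*L, −H)`, where `(S*)ᵢⱼ = Sⱼᵢ*` and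
`(S*L)ᵢ = Σⱼ Sⱼᵢ* Lⱼ`. -/
noncomputable def inv (G : SLH 𝔥 n) : SLH 𝔥 n where
  S := fun i j => star (G.S j i)
  L := fun i => -∑ j, star (G.S j i) * G.L j
  H := -G.H

end SLH

namespace SLH

section

variable {𝔥 : Type*} [NormedAddCommGroup 𝔥] [InnerProductSpace ℂ 𝔥] [CompleteSpace 𝔥] {n : ℕ}

theorem opIm_eq_zero {A : 𝔥 →L[ℂ] 𝔥} (hA : IsSelfAdjoint A) : opIm A = 0 := by
  rw [opIm, hA.star_eq, sub_self, smul_zero]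

theorem isSelfAdjoint_neg_sum_star_mul_self (a : Fin n → 𝔥 →L[ℂ] 𝔥) :
    IsSelfAdjoint (-∑ i, star (a i) * a i) :=
  (isSelfAdjoint_sum _ fun i _ => IsSelfAdjoint.star_mul_self (a i)).neg

theorem IsUnitaryMatrix.sum_mul_sum_star_mul {S : Matrix (Fin n) (Fin n) (𝔥 →L[ℂ] 𝔥)}
    (hS : IsUnitaryMatrix S) (L : Fin n → 𝔥 →L[ℂ] 𝔥) (i : Fin n) :
    ∑ j, S i j * ∑ k, star (S k j) * L k = L i := by
  simp_rw [Finset.mul_sum, ← mul_assoc]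
  rw [Finset.sum_comm]
  simp_rw [← Finset.sum_mul, hS.2]
  simp

theorem ext_fields {G₁ G₂ : SLH 𝔥 n} (hS : G₁.S = G₂.S) (hL : G₁.L = G₂.L)
    (hH : G₁.H = G₂.H) : G₁ = G₂ := by
  cases G₁
  cases G₂
  simp_all

theorem inv_series_self {G : SLH 𝔥 n} (hG : G.IsModel) : series (inv G) G = trivialModel 𝔥 n := by
  refine ext_fields ?_ ?_ ?_
  · ext1 i j
    simp only [series, inv, trivialModel, Matrix.one_apply]
    exact hG.1.1 i j
  · funext i
    simp [series, inv, trivialModel]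
  · simp only [series, inv, trivialModel, ← Finset.mul_sum, star_neg, neg_mul,
      Finset.sum_neg_distrib, add_neg_cancel, zero_add]
    exact opIm_eq_zero (isSelfAdjoint_neg_sum_star_mul_self _)

theorem series_inv_self {G : SLH 𝔥 n} (hG : G.IsModel) : series G (inv G) = trivialModel 𝔥 n := by
  refine ext_fields ?_ ?_ ?_
  · ext1 i j
    simp only [series, inv, trivialModel, Matrix.one_apply]
    exact hG.1.2 i j
  · funext i
    simp only [series, inv, trivialModel, mul_neg, Finset.sum_neg_distrib,
      hG.1.sum_mul_sum_star_mul, add_neg_cancel]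
  · simp only [series, inv, trivialModel, ← Finset.mul_sum, mul_neg, Finset.sum_neg_distrib,
      hG.1.sum_mul_sum_star_mul, neg_add_cancel, zero_add]
    exact opIm_eq_zero (isSelfAdjoint_neg_sum_star_mul_self _)

end

end SLH

/-- `G⁻¹ = (S*, −S*L, −H)` is a two-sided inverse of `G` for the series product. -/
theorem series_product_inverse {𝔥 : Type*} [NormedAddCommGroup 𝔥] [InnerProductSpace ℂ 𝔥]
    [CompleteSpace 𝔥] {n : ℕ} (G : SLH 𝔥 n) (hG : G.IsModel) :
    SLH.series (SLH.inv G) G = SLH.trivialModel 𝔥 n ∧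
    SLH.series G (SLH.inv G) = SLH.trivialModel 𝔥 n :=
  ⟨SLH.inv_series_self hG, SLH.series_inv_self hG⟩
end

section
/- The series product is compatible with the damping-operator representation: for SLH models G₁ = (S₁, L₁, H₁) and G₂ = (S₂, L₂, H₂), setting K(L, H) := −½ Σᵢ Lᵢ*Lᵢ − iH, the damping operator of the series product G₂ ◁ G₁ = (S₂S₁, L₂ + S₂L₁, H₁ + H₂ + Im{L₂*S₂L₁}) satisfies K(L₂ + S₂L₁, H₁ + H₂ + Im{L₂*S₂L₁}) = K(L₁, H₁) + K(L₂, H₂) − Σ_{ij} L₂ᵢ* S₂ᵢⱼ L₁ⱼ. In other words, in the triple representation [S, L, K] the series product takes the form [S₂, L₂, K₂] ◁ [S₁, L₁, K₁] = [S₂S₁, L₂ + S₂L₁, K₁ + K₂ − L₂*S₂L₁]. -/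
/-!
STATEMENT 3: Compatibility of the series product with the damping-operator
representation `K(L, H) = −½ Σᵢ Lᵢ*Lᵢ − iH`.
-/

open Complex

variable {𝔥 : Type*} [NormedAddCommGroup 𝔥] [InnerProductSpace ℂ 𝔥] [CompleteSpace 𝔥] {n : ℕ}

/-- `Im{A} = (A - A*)/(2i)`. -/
noncomputable def opIm (A : 𝔥 →L[ℂ] 𝔥) : 𝔥 →L[ℂ] 𝔥 :=
  (2 * Complex.I)⁻¹ • (A - star A)

/-- The damping operator `K(L, H) = −½ Σᵢ Lᵢ*Lᵢ − iH`. -/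
noncomputable def dampingOp (L : Fin n → 𝔥 →L[ℂ] 𝔥) (H : 𝔥 →L[ℂ] 𝔥) : 𝔥 →L[ℂ] 𝔥 :=
  -((2 : ℂ)⁻¹ • ∑ i, star (L i) * L i) - Complex.I • H

/-- `S` is unitary as an operator on `𝔥ⁿ`. -/
def IsUnitaryMatrix (S : Matrix (Fin n) (Fin n) (𝔥 →L[ℂ] 𝔥)) : Prop :=
  (∀ i j, ∑ k, star (S k i) * S k j = if i = j then 1 else 0) ∧
  (∀ i j, ∑ k, S i k * star (S j k) = if i = j then 1 else 0)

/-- Multiplication by a matrix with orthonormal columns preserves `∑ i, star (L i) * L i`. -/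
theorem IsUnitaryMatrix.sum_star_mul_self {S : Matrix (Fin n) (Fin n) (𝔥 →L[ℂ] 𝔥)}
    (hS : IsUnitaryMatrix S) (L : Fin n → 𝔥 →L[ℂ] 𝔥) :
    ∑ i, star (∑ j, S i j * L j) * ∑ j, S i j * L j = ∑ i, star (L i) * L i := by
  calc ∑ i, star (∑ j, S i j * L j) * ∑ j, S i j * L j
      = ∑ i, ∑ j, ∑ k, star (L j) * (star (S i j) * S i k) * L k := by
        simp only [star_sum, star_mul, Finset.sum_mul_sum, mul_assoc]
    _ = ∑ j, ∑ k, star (L j) * (∑ i, star (S i j) * S i k) * L k := by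
        rw [Finset.sum_comm]
        refine Finset.sum_congr rfl fun j _ => ?_
        rw [Finset.sum_comm]
        simp only [Finset.mul_sum, Finset.sum_mul]
    _ = ∑ i, star (L i) * L i := by
        simp [hS.1]

/-- `i Im{A} = (A - A*)/2`. -/
theorem I_smul_opIm (A : 𝔥 →L[ℂ] 𝔥) : Complex.I • opIm A = (2 : ℂ)⁻¹ • (A - star A) := by
  rw [opIm, smul_smul]
  congr 1
  field_simp [Complex.I_ne_zero]

/-- The damping operator of the series product
`G₂ ◁ G₁ = (S₂S₁, L₂ + S₂L₁, H₁ + H₂ + Im{L₂*S₂L₁})` is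
`K₁ + K₂ − L₂*S₂L₁`. -/
theorem damping_of_series_product
    (S₁ S₂ : Matrix (Fin n) (Fin n) (𝔥 →L[ℂ] 𝔥)) (L₁ L₂ : Fin n → 𝔥 →L[ℂ] 𝔥)
    (H₁ H₂ : 𝔥 →L[ℂ] 𝔥)
    (hS₁ : IsUnitaryMatrix S₁) (hS₂ : IsUnitaryMatrix S₂)
    (hH₁ : IsSelfAdjoint H₁) (hH₂ : IsSelfAdjoint H₂) :
    dampingOp (fun i => L₂ i + ∑ j, S₂ i j * L₁ j)
        (H₁ + H₂ + opIm (∑ i, ∑ j, star (L₂ i) * (S₂ i j * L₁ j))) =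
      dampingOp L₁ H₁ + dampingOp L₂ H₂ - ∑ i, ∑ j, star (L₂ i) * (S₂ i j * L₁ j) := by
  set A := ∑ i, ∑ j, star (L₂ i) * (S₂ i j * L₁ j) with hA
  have hcross : ∑ i, star (L₂ i) * ∑ j, S₂ i j * L₁ j = A := by
    simp only [hA, Finset.mul_sum]
  have hcross_star : ∑ i, star (∑ j, S₂ i j * L₁ j) * L₂ i = star A := by
    simp only [← hcross, star_sum, star_mul, star_star]
  have hquad : ∑ i, star (L₂ i + ∑ j, S₂ i j * L₁ j) * (L₂ i + ∑ j, S₂ i j * L₁ j) =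
      ∑ i, star (L₂ i) * L₂ i + A + (star A + ∑ i, star (L₁ i) * L₁ i) := by
    rw [← hS₂.sum_star_mul_self L₁, ← hcross_star, ← hcross]
    simp only [star_add, add_mul, mul_add, Finset.sum_add_distrib]
    abel
  simp only [dampingOp, hquad, smul_add, I_smul_opIm]
  module
end

section
/- Virtual work of a perturbation generated by an observable equals minus its Lindbladian: let L = (L₁,…,Lₙ) be an n-tuple of bounded operators, and H, F bounded self-adjoint operators on a complex Hilbert space 𝔥. Set δLᵢ := −i[Lᵢ, F] and δH := −i[H, F] (which is self-adjoint). Then δH + Im{Σᵢ (δLᵢ)* Lᵢ} = −𝓛(F), where 𝓛(F) = Σᵢ Lᵢ* F Lᵢ − ½ Σᵢ (Lᵢ*Lᵢ F + F Lᵢ*Lᵢ) − i[F, H] and Im{A} := (A − A*)/(2i). In particular, if F is a constant of the motion (𝓛(F) = 0) then the virtual work δH + Im{Σᵢ (δLᵢ)* Lᵢ} is zero. -/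
/-!
STATEMENT 8: The virtual work of the perturbation generated by an observable `F`
equals minus the Lindbladian of `F`:
`δH + Im{Σᵢ (δLᵢ)* Lᵢ} = −𝓛(F)` for `δLᵢ = −i[Lᵢ, F]`, `δH = −i[H, F]`.
-/

open Complex

variable {𝔥 : Type*} [NormedAddCommGroup 𝔥] [InnerProductSpace ℂ 𝔥] [CompleteSpace 𝔥] {n : ℕ}

/-- The Lindblad generator
`𝓛(X) = Σᵢ Lᵢ* X Lᵢ − ½ Σᵢ (Lᵢ*Lᵢ X + X Lᵢ*Lᵢ) − i[X, H]`. -/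
noncomputable def lindblad (L : Fin n → 𝔥 →L[ℂ] 𝔥) (H X : 𝔥 →L[ℂ] 𝔥) : 𝔥 →L[ℂ] 𝔥 :=
  (∑ i, star (L i) * X * L i)
    - (2 : ℂ)⁻¹ • ∑ i, (star (L i) * L i * X + X * (star (L i) * L i))
    - Complex.I • (X * H - H * X)

theorem opIm_sum {ι : Type*} (s : Finset ι) (A : ι → 𝔥 →L[ℂ] 𝔥) :
    opIm (∑ i ∈ s, A i) = ∑ i ∈ s, opIm (A i) := by
  simp only [opIm, star_sum, ← Finset.sum_sub_distrib, Finset.smul_sum]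

theorem opIm_star_commutator_mul (A : 𝔥 →L[ℂ] 𝔥) {F : 𝔥 →L[ℂ] 𝔥} (hF : IsSelfAdjoint F) :
    opIm (star (-Complex.I • (A * F - F * A)) * A) =
      (2 : ℂ)⁻¹ • (star A * A * F + F * (star A * A)) - star A * F * A := by
  have hI : (2 * Complex.I)⁻¹ * Complex.I = (2 : ℂ)⁻¹ := by
    field_simp [Complex.I_ne_zero]
  have hdiff : star (-Complex.I • (A * F - F * A)) * A
        - star (star (-Complex.I • (A * F - F * A)) * A) =
      Complex.I • (star A * A * F + F * (star A * A) - (2 : ℂ) • (star A * F * A)) := by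
    simp only [star_mul, star_star, star_smul, star_sub, hF.star_eq, star_neg,
      RCLike.star_def, Complex.conj_I, neg_neg, smul_mul_assoc, sub_mul,
      mul_assoc]
    module
  rw [opIm, hdiff, smul_smul, hI]
  module

/-- With `δLᵢ := −i[Lᵢ, F]` and `δH := −i[H, F]`, the virtual work
`δH + Im{Σᵢ (δLᵢ)* Lᵢ}` equals `−𝓛(F)`; in particular it vanishes if `F` is a
constant of the motion. -/
theorem virtual_work_eq_neg_lindbladian
    (L : Fin n → 𝔥 →L[ℂ] 𝔥) (H F : 𝔥 →L[ℂ] 𝔥)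
    (hH : IsSelfAdjoint H) (hF : IsSelfAdjoint F) :
    (-Complex.I • (H * F - F * H)
        + opIm (∑ i, star (-Complex.I • (L i * F - F * L i)) * L i) =
      -lindblad L H F) ∧
    (lindblad L H F = 0 →
      -Complex.I • (H * F - F * H)
        + opIm (∑ i, star (-Complex.I • (L i * F - F * L i)) * L i) = 0) := by
  have key : -Complex.I • (H * F - F * H)
        + opIm (∑ i, star (-Complex.I • (L i * F - F * L i)) * L i) = -lindblad L H F := by
    have him : opIm (∑ i, star (-Complex.I • (L i * F - F * L i)) * L i) =
        (2 : ℂ)⁻¹ • (∑ i, (star (L i) * L i * F + F * (star (L i) * L i)))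
          - ∑ i, star (L i) * F * L i := by
      rw [opIm_sum, Finset.smul_sum, ← Finset.sum_sub_distrib]
      exact Finset.sum_congr rfl fun i _ => opIm_star_commutator_mul (L i) hF
    rw [him, lindblad]
    module
  exact ⟨key, fun h => by rw [key, h, neg_zero]⟩
end

section
/- Convergence of the squeezing Hamiltonian correction: let L be a bounded operator on a complex Hilbert space 𝔥 and θ ∈ ℝ with cos θ ≠ −1. For n ∈ ℕ let ν(n) := 2n + 1 + 2√(n(n+1)) cos θ, c_n := (n + √(n(n+1)) e^{−iθ})/ν(n), d_n := √(n(n+1))/ν(n), and define H_n := (2i)⁻¹ (c_n L² − c̄_n (L*)²) − d_n sin θ · L*L. Then H_n = ν(n)^{−1/2} Im{L* F^{(n)}} where F^{(n)} = ν(n)^{−1/2}[(n + √(n(n+1)) e^{−iθ}) L − (n + √(n(n+1)) e^{iθ}) L*], and H_n converges in operator norm as n → ∞ to H' := (2i)⁻¹ (c L² − c̄ (L*)²) − (sin θ/(2(1 + cos θ))) L*L with c = (1 + e^{−iθ})/(2(1 + cos θ)). -/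
/-!
STATEMENT 15: Convergence of the squeezing Hamiltonian correction
`H_n = ν(n)^{−1/2} Im{L* F^{(n)}} → H'` in operator norm.
-/

open Complex Filter Topology

variable {𝔥 : Type*} [NormedAddCommGroup 𝔥] [InnerProductSpace ℂ 𝔥] [CompleteSpace 𝔥]

/-- `ν(n) = 2n + 1 + 2√(n(n+1)) cos θ`. -/
noncomputable def nuSq (θ : ℝ) (n : ℕ) : ℝ :=
  2 * n + 1 + 2 * Real.sqrt (n * (n + 1)) * Real.cos θ

/-- `c_n = (n + √(n(n+1)) e^{−iθ})/ν(n)`. -/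
noncomputable def cSq (θ : ℝ) (n : ℕ) : ℂ :=
  ((n : ℂ) + (Real.sqrt (n * (n + 1)) : ℂ) * Complex.exp (-(θ : ℂ) * Complex.I)) /
    ((nuSq θ n : ℝ) : ℂ)

/-- `d_n = √(n(n+1))/ν(n)`. -/
noncomputable def dSq (θ : ℝ) (n : ℕ) : ℝ :=
  Real.sqrt (n * (n + 1)) / nuSq θ n

/-- `H_n = (2i)⁻¹ (c_n L² − c̄_n (L*)²) − d_n sin θ · L*L`. -/
noncomputable def Hsq (L : 𝔥 →L[ℂ] 𝔥) (θ : ℝ) (n : ℕ) : 𝔥 →L[ℂ] 𝔥 :=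
  (2 * Complex.I)⁻¹ • (cSq θ n • (L * L) - starRingEnd ℂ (cSq θ n) • (star L * star L))
    - ((dSq θ n * Real.sin θ : ℝ) : ℂ) • (star L * L)

/-- `F^{(n)} = ν(n)^{−1/2}[(n + √(n(n+1)) e^{−iθ}) L − (n + √(n(n+1)) e^{iθ}) L*]`. -/
noncomputable def FsqN (L : 𝔥 →L[ℂ] 𝔥) (θ : ℝ) (n : ℕ) : 𝔥 →L[ℂ] 𝔥 :=
  (((Real.sqrt (nuSq θ n) : ℝ) : ℂ))⁻¹ •
    (((n : ℂ) + (Real.sqrt (n * (n + 1)) : ℂ) * Complex.exp (-(θ : ℂ) * Complex.I)) • L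
      - ((n : ℂ) + (Real.sqrt (n * (n + 1)) : ℂ) * Complex.exp ((θ : ℂ) * Complex.I)) • star L)

lemma nuSq_nonneg (θ : ℝ) (n : ℕ) : 0 ≤ nuSq θ n := by
  have hn : (0 : ℝ) ≤ n := n.cast_nonneg
  have hs : Real.sqrt (n * (n + 1)) ≤ n + 1 / 2 :=
    Real.sqrt_le_iff.2 ⟨by linarith, by nlinarith⟩
  have hc := mul_le_mul_of_nonneg_left (Real.neg_one_le_cos θ)
    (Real.sqrt_nonneg ((n : ℝ) * (n + 1)))
  unfold nuSq
  linarith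

lemma tendsto_sqrt_mul_succ_div :
    Tendsto (fun n : ℕ => Real.sqrt (n * (n + 1)) / n) atTop (𝓝 1) := by
  have h : Tendsto (fun n : ℕ => Real.sqrt (1 + 1 / (n : ℝ))) atTop (𝓝 1) := by
    simpa using (tendsto_one_div_atTop_nhds_zero_nat (𝕜 := ℝ)).const_add 1 |>.sqrt
  refine h.congr' ?_
  filter_upwards [eventually_gt_atTop 0] with n hn
  have hn' : (0 : ℝ) < n := Nat.cast_pos.2 hn
  rw [eq_div_iff hn'.ne', ← Real.sqrt_sq hn'.le, ← Real.sqrt_mul (by positivity),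
    Real.sqrt_sq hn'.le]
  congr 1
  field_simp

lemma tendsto_nuSq_div {θ : ℝ} :
    Tendsto (fun n : ℕ => nuSq θ n / n) atTop (𝓝 (2 * (1 + Real.cos θ))) := by
  have h := ((tendsto_one_div_atTop_nhds_zero_nat (𝕜 := ℝ)).const_add 2).add
    ((tendsto_sqrt_mul_succ_div.const_mul 2).mul_const (Real.cos θ))
  rw [show 2 * (1 + Real.cos θ) = 2 + 0 + 2 * 1 * Real.cos θ by ring]
  refine h.congr' ?_
  filter_upwards [eventually_gt_atTop 0] with n hn
  have hn' : (n : ℝ) ≠ 0 := Nat.cast_ne_zero.2 hn.ne'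
  unfold nuSq
  field_simp

lemma tendsto_natCast_div_nuSq {θ : ℝ} (hθ : Real.cos θ ≠ -1) :
    Tendsto (fun n : ℕ => n / nuSq θ n) atTop (𝓝 (1 / (2 * (1 + Real.cos θ)))) := by
  have h0 : 2 * (1 + Real.cos θ) ≠ 0 :=
    mul_ne_zero two_ne_zero fun h => hθ (by linarith)
  simpa using tendsto_nuSq_div.inv₀ h0

lemma tendsto_dSq {θ : ℝ} (hθ : Real.cos θ ≠ -1) :
    Tendsto (dSq θ) atTop (𝓝 (1 / (2 * (1 + Real.cos θ)))) := by
  have h := tendsto_sqrt_mul_succ_div.mul (tendsto_natCast_div_nuSq hθ)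
  rw [one_mul] at h
  refine h.congr' ?_
  filter_upwards [eventually_gt_atTop 0] with n hn
  exact div_mul_div_cancel₀ (Nat.cast_ne_zero.2 hn.ne')

lemma tendsto_cSq {θ : ℝ} (hθ : Real.cos θ ≠ -1) :
    Tendsto (cSq θ) atTop
      (𝓝 ((1 + Complex.exp (-(θ : ℂ) * Complex.I)) / ((2 * (1 + Real.cos θ) : ℝ) : ℂ))) := by
  have h1 := (Complex.continuous_ofReal.tendsto _).comp (tendsto_natCast_div_nuSq hθ)
  have h2 := (Complex.continuous_ofReal.tendsto _).comp (tendsto_dSq hθ)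
  have h := h1.add (h2.mul_const (Complex.exp (-(θ : ℂ) * Complex.I)))
  convert h using 2
  · simp only [cSq, dSq, Function.comp, Complex.ofReal_div, Complex.ofReal_natCast]
    ring
  · simp only [Complex.ofReal_div, Complex.ofReal_one]
    ring

lemma conj_exp_neg_ofReal_mul_I (θ : ℝ) :
    starRingEnd ℂ (Complex.exp (-(θ : ℂ) * Complex.I)) = Complex.exp ((θ : ℂ) * Complex.I) := by
  rw [← Complex.exp_conj]
  simp

lemma Hsq_eq_smul_opIm (L : 𝔥 →L[ℂ] 𝔥) (θ : ℝ) (n : ℕ) :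
    Hsq L θ n = (((Real.sqrt (nuSq θ n) : ℝ) : ℂ))⁻¹ • opIm (star L * FsqN L θ n) := by
  have hν : ((Real.sqrt (nuSq θ n) : ℝ) : ℂ)⁻¹ * ((Real.sqrt (nuSq θ n) : ℝ) : ℂ)⁻¹ =
      ((nuSq θ n : ℝ) : ℂ)⁻¹ := by
    rw [← mul_inv, ← Complex.ofReal_mul, Real.mul_self_sqrt (nuSq_nonneg θ n)]
  have hconj := conj_exp_neg_ofReal_mul_I θ
  have hconj' : starRingEnd ℂ (Complex.exp ((θ : ℂ) * Complex.I)) =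
      Complex.exp (-(θ : ℂ) * Complex.I) := by rw [← hconj, Complex.conj_conj]
  have hsin : Complex.exp ((θ : ℂ) * Complex.I) - Complex.exp (-(θ : ℂ) * Complex.I) =
      2 * Complex.I * Complex.sin θ := by
    rw [Complex.sin]
    linear_combination (Complex.exp (-(θ : ℂ) * Complex.I) -
      Complex.exp ((θ : ℂ) * Complex.I)) * (-Complex.I_sq)
  simp only [Hsq, opIm, FsqN, cSq, dSq, mul_smul_comm, mul_sub, star_smul, star_sub, star_mul,
    star_star, RCLike.star_def, map_div₀, map_add, map_mul, map_inv₀, Complex.conj_ofReal,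
    map_natCast, hconj, hconj', Complex.ofReal_mul, Complex.ofReal_div, Complex.ofReal_sin]
  generalize Complex.exp ((θ : ℂ) * Complex.I) = u at *
  generalize Complex.exp (-(θ : ℂ) * Complex.I) = v at *
  have hs : Complex.sin θ = (2 * Complex.I)⁻¹ * (u - v) := by
    rw [hsin, inv_mul_cancel_left₀ (by simp)]
  rw [hs]
  simp only [div_eq_mul_inv, ← hν]
  module

/-- `H_n = ν(n)^{−1/2} Im{L* F^{(n)}}`, and `H_n` converges in operator norm to
`H' = (2i)⁻¹(c L² − c̄ (L*)²) − (sin θ/(2(1 + cos θ))) L*L` with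
`c = (1 + e^{−iθ})/(2(1 + cos θ))`. -/
theorem squeezing_hamiltonian_convergence (L : 𝔥 →L[ℂ] 𝔥) (θ : ℝ) (hθ : Real.cos θ ≠ -1) :
    (∀ n : ℕ,
      Hsq L θ n = (((Real.sqrt (nuSq θ n) : ℝ) : ℂ))⁻¹ • opIm (star L * FsqN L θ n)) ∧
    Tendsto (fun n : ℕ => Hsq L θ n) atTop
      (𝓝 ((2 * Complex.I)⁻¹ •
            (((1 + Complex.exp (-(θ : ℂ) * Complex.I)) / ((2 * (1 + Real.cos θ) : ℝ) : ℂ)) •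
                (L * L)
              - starRingEnd ℂ
                  ((1 + Complex.exp (-(θ : ℂ) * Complex.I)) / ((2 * (1 + Real.cos θ) : ℝ) : ℂ)) •
                (star L * star L))
          - ((Real.sin θ / (2 * (1 + Real.cos θ)) : ℝ) : ℂ) • (star L * L))) := by
  refine ⟨Hsq_eq_smul_opIm L θ, ?_⟩
  have hc := tendsto_cSq hθ
  have hd := (Complex.continuous_ofReal.tendsto _).comp
    ((tendsto_dSq hθ).mul_const (Real.sin θ))
  rw [one_div_mul_eq_div] at hd
  exact (((hc.smul_const (L * L)).sub
    (((Complex.continuous_conj.tendsto _).comp hc).smul_const (star L * star L))).const_smul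
      (2 * Complex.I)⁻¹).sub (hd.smul_const (star L * L))
end

section
/- Exact decoupling of the polarization channels by a right series perturbation: let F be a bounded self-adjoint operator on a complex Hilbert space 𝔥, κ ∈ ℝ, α ∈ ℂ, and k > 0. Define the 2×2 operator matrix S^{(k)} := [[cos(κF/k), −sin(κF/k)], [sin(κF/k), cos(κF/k)]] (functions via continuous functional calculus), the coupling vector L^{(k)} := (−k sin(κF/k) α, k cos(κF/k) α), and the perturbation δG^{(k)} := (S^{(k)*}, S^{(k)*}·(k sin(κF/k) α − κF α, k(1 − cos(κF/k)) α), 0). Then G^{(k)} ◁ δG^{(k)} = (I₂, (−κF α, k α), 0), where G^{(k)} = (S^{(k)}, L^{(k)}, 0); in particular S^{(k)} S^{(k)*} = I₂ and the Hamiltonian component Im{(L^{(k)})* S^{(k)} δL^{(k)}} vanishes. -/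
/-!
STATEMENT 17: Exact decoupling of the polarization channels by a right series
perturbation in the Faraday rotation model:
`G^{(k)} ◁ δG^{(k)} = (I₂, (−κFα, kα), 0)`.
-/

open Complex Matrix

section Faraday

variable {𝔥 : Type*} [NormedAddCommGroup 𝔥] [InnerProductSpace ℂ 𝔥] [CompleteSpace 𝔥]

/-- The Faraday scattering matrix `[[cos(κF/k), −sin(κF/k)], [sin(κF/k), cos(κF/k)]]`
(via the continuous functional calculus). -/
noncomputable def faradayS (F : 𝔥 →L[ℂ] 𝔥) (κ k : ℝ) : Matrix (Fin 2) (Fin 2) (𝔥 →L[ℂ] 𝔥) :=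
  !![cfc Real.cos ((κ / k) • F), -cfc Real.sin ((κ / k) • F);
     cfc Real.sin ((κ / k) • F), cfc Real.cos ((κ / k) • F)]

/-- The Faraday coupling vector `(−k sin(κF/k) α, k cos(κF/k) α)`. -/
noncomputable def faradayL (F : 𝔥 →L[ℂ] 𝔥) (κ k : ℝ) (α : ℂ) : Fin 2 → 𝔥 →L[ℂ] 𝔥 :=
  ![(-(((k : ℂ)) * α)) • cfc Real.sin ((κ / k) • F),
    (((k : ℂ)) * α) • cfc Real.cos ((κ / k) • F)]

/-- The coupling vector of the perturbation `δG^{(k)}`, before multiplication by `S^{(k)*}`: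
`(k sin(κF/k) α − κF α, k(1 − cos(κF/k)) α)`. -/
noncomputable def faradayW (F : 𝔥 →L[ℂ] 𝔥) (κ k : ℝ) (α : ℂ) : Fin 2 → 𝔥 →L[ℂ] 𝔥 :=
  ![(((k : ℂ)) * α) • cfc Real.sin ((κ / k) • F) - (((κ : ℂ)) * α) • F,
    (((k : ℂ)) * α) • ((1 : 𝔥 →L[ℂ] 𝔥) - cfc Real.cos ((κ / k) • F))]

end Faraday

section FaradayLemmas

variable {𝔥 : Type*} [NormedAddCommGroup 𝔥] [InnerProductSpace ℂ 𝔥] [CompleteSpace 𝔥]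

theorem SLH.opIm_eq_zero_s17 {A : 𝔥 →L[ℂ] 𝔥} (hA : IsSelfAdjoint A) : SLH.opIm A = 0 := by
  simp [SLH.opIm, hA.star_eq]

theorem cfc_cos_mul_self_add_cfc_sin_mul_self {A : 𝔥 →L[ℂ] 𝔥} (hA : IsSelfAdjoint A) :
    cfc Real.cos A * cfc Real.cos A + cfc Real.sin A * cfc Real.sin A = 1 := by
  rw [← cfc_mul Real.cos Real.cos A, ← cfc_mul Real.sin Real.sin A,
    ← cfc_add A (fun x => Real.cos x * Real.cos x) (fun x => Real.sin x * Real.sin x)]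
  simp only [← sq, Real.cos_sq_add_sin_sq]
  exact cfc_const_one ℝ A

theorem faradayS_mul_conjTranspose {F : 𝔥 →L[ℂ] 𝔥} (hF : IsSelfAdjoint F) (κ k : ℝ) :
    faradayS F κ k * (faradayS F κ k)ᴴ = 1 := by
  have hA : IsSelfAdjoint ((κ / k) • F) := (IsSelfAdjoint.all (κ / k)).smul hF
  have hc : star (cfc Real.cos ((κ / k) • F)) = cfc Real.cos ((κ / k) • F) :=
    (cfc_predicate Real.cos ((κ / k) • F) : IsSelfAdjoint _)
  have hs : star (cfc Real.sin ((κ / k) • F)) = cfc Real.sin ((κ / k) • F) :=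
    (cfc_predicate Real.sin ((κ / k) • F) : IsSelfAdjoint _)
  have hcs := cfc_cos_mul_self_add_cfc_sin_mul_self hA
  have hcomm : Commute (cfc Real.cos ((κ / k) • F)) (cfc Real.sin ((κ / k) • F)) :=
    cfc_commute_cfc _ _ _
  ext1 i j
  fin_cases i <;> fin_cases j <;>
    simp [faradayS, Matrix.mul_apply, Fin.sum_univ_two, hc, hs, hcs, hcomm.eq,
      add_comm (cfc Real.sin _ * cfc Real.sin _)]

theorem sum_faradayS_mul_sum_conjTranspose_mul {F : 𝔥 →L[ℂ] 𝔥} (hF : IsSelfAdjoint F) (κ k : ℝ)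
    (w : Fin 2 → 𝔥 →L[ℂ] 𝔥) (i : Fin 2) :
    ∑ j, faradayS F κ k i j * ∑ p, (faradayS F κ k)ᴴ j p * w p = w i := by
  change (faradayS F κ k *ᵥ ((faradayS F κ k)ᴴ *ᵥ w)) i = w i
  rw [Matrix.mulVec_mulVec, faradayS_mul_conjTranspose hF, Matrix.one_mulVec]

theorem isSelfAdjoint_sum_star_faradayL_mul_faradayW {F : 𝔥 →L[ℂ] 𝔥} (hF : IsSelfAdjoint F)
    (κ k : ℝ) (α : ℂ) :
    IsSelfAdjoint (∑ i, star (faradayL F κ k α i) * faradayW F κ k α i) := by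
  have hA : IsSelfAdjoint ((κ / k) • F) := (IsSelfAdjoint.all (κ / k)).smul hF
  have hc : star (cfc Real.cos ((κ / k) • F)) = cfc Real.cos ((κ / k) • F) :=
    (cfc_predicate Real.cos ((κ / k) • F) : IsSelfAdjoint _)
  have hs : star (cfc Real.sin ((κ / k) • F)) = cfc Real.sin ((κ / k) • F) :=
    (cfc_predicate Real.sin ((κ / k) • F) : IsSelfAdjoint _)
  have hcomm : cfc Real.sin ((κ / k) • F) * F = F * cfc Real.sin ((κ / k) • F) :=
    (Commute.cfc_real (b := F) ((Commute.refl F).smul_left (κ / k)) Real.sin).eq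
  rw [isSelfAdjoint_iff]
  simp only [faradayL, faradayW, Fin.sum_univ_two, Matrix.cons_val_zero, Matrix.cons_val_one,
    star_add, star_mul, star_sub, star_smul, hc, hs, hF.star_eq, mul_sub, smul_mul_assoc, mul_smul_comm,
    smul_sub, smul_smul, mul_one, hcomm, star_neg, RCLike.star_def, Complex.conj_ofReal,
    Complex.conj_conj]
  module

end FaradayLemmas

/-- The right series perturbation
`δG^{(k)} = (S^{(k)*}, S^{(k)*}·(k sin(κF/k)α − κFα, k(1 − cos(κF/k))α), 0)`
exactly decouples the polarization channels:
`G^{(k)} ◁ δG^{(k)} = (I₂, (−κFα, kα), 0)`; in particular `S^{(k)} S^{(k)*} = I₂`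
and the Hamiltonian component `Im{(L^{(k)})* S^{(k)} δL^{(k)}}` vanishes. -/
theorem faraday_decoupling {𝔥 : Type*} [NormedAddCommGroup 𝔥] [InnerProductSpace ℂ 𝔥]
    [CompleteSpace 𝔥] (F : 𝔥 →L[ℂ] 𝔥) (hF : IsSelfAdjoint F) (κ : ℝ) (α : ℂ)
    (k : ℝ) (hk : 0 < k) :
    SLH.series ⟨faradayS F κ k, faradayL F κ k α, 0⟩
        ⟨(faradayS F κ k)ᴴ, fun i => ∑ j, (faradayS F κ k)ᴴ i j * faradayW F κ k α j, 0⟩ =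
      ⟨1, ![(-(((κ : ℂ)) * α)) • F, (((k : ℂ)) * α) • (1 : 𝔥 →L[ℂ] 𝔥)], 0⟩ ∧
    faradayS F κ k * (faradayS F κ k)ᴴ = 1 ∧
    SLH.opIm (∑ i, ∑ j, star (faradayL F κ k α i) *
        (faradayS F κ k i j * (∑ p, (faradayS F κ k)ᴴ j p * faradayW F κ k α p))) = 0 := by
  have hIm : SLH.opIm (∑ i, ∑ j, star (faradayL F κ k α i) *
      (faradayS F κ k i j * (∑ p, (faradayS F κ k)ᴴ j p * faradayW F κ k α p))) = 0 := by
    simp only [← Finset.mul_sum, sum_faradayS_mul_sum_conjTranspose_mul hF]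
    exact SLH.opIm_eq_zero_s17 (isSelfAdjoint_sum_star_faradayL_mul_faradayW hF κ k α)
  refine ⟨?_, faradayS_mul_conjTranspose hF κ k, hIm⟩
  simp only [SLH.series, faradayS_mul_conjTranspose hF, hIm,
    sum_faradayS_mul_sum_conjTranspose_mul hF, add_zero, SLH.mk.injEq, and_true, true_and]
  ext1 i
  fin_cases i
  · simp [faradayL, faradayW, ← add_sub_assoc]
  · simp [faradayL, faradayW, smul_sub]
end

section
/- Local asymptotic normality perturbation converges to the trivial model: let L, L', L'' be bounded operators and H, H', H'' bounded self-adjoint operators on a complex Hilbert space 𝔥, let v ∈ ℝ, and let R_L, R_H map reals to bounded operators (R_H(x) self-adjoint) with ‖R_L(x)‖/x² → 0 and ‖R_H(x)‖/x² → 0 as x → 0. For k ∈ ℕ, k ≥ 1, define L_k := kL + vL' + (v²/(2k))L'' + k·R_L(v/k), H_k := k²H + kvH' + (v²/2)H'' + k²·R_H(v/k), and the truncated model coefficients L̃_k := kL + vL', H̃_k := k²H + kvH' + (v²/2)H'' + (v²/2)·Im{(L'')* L}. Let δG_k := (G_k)⁻¹ ◁ G̃_k, where G_k = (I, L_k, H_k),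 G̃_k = (I, L̃_k, H̃_k), and the inverse and series product are as for SLH models. Then δG_k has scattering component I, and its coupling component L̃_k − L_k = −(v²/(2k))L'' − k·R_L(v/k) and its Hamiltonian component H̃_k − H_k + Im{(−L_k)* L̃_k} both converge to 0 in operator norm as k → ∞. -/
/-!
STATEMENT 18: The local asymptotic normality perturbation
`δG_k = (G_k)⁻¹ ◁ G̃_k` converges to the trivial model `E = (I, 0, 0)`.
-/

open Complex Filter Topology Asymptotics

variable {𝔥 : Type*} [NormedAddCommGroup 𝔥] [InnerProductSpace ℂ 𝔥] [CompleteSpace 𝔥]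

/-- The scaled coupling `L_k = kL + vL' + (v²/(2k))L'' + k·R_L(v/k)`. -/
noncomputable def lanL (L L' L'' : 𝔥 →L[ℂ] 𝔥) (RL : ℝ → 𝔥 →L[ℂ] 𝔥) (v : ℝ) (k : ℕ) :
    𝔥 →L[ℂ] 𝔥 :=
  (k : ℂ) • L + (v : ℂ) • L' + (((v : ℂ) ^ 2) / (2 * (k : ℂ))) • L''
    + (k : ℂ) • RL (v / k)

/-- The scaled Hamiltonian `H_k = k²H + kvH' + (v²/2)H'' + k²·R_H(v/k)`. -/
noncomputable def lanH (H H' H'' : 𝔥 →L[ℂ] 𝔥) (RH : ℝ → 𝔥 →L[ℂ] 𝔥) (v : ℝ) (k : ℕ) :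
    𝔥 →L[ℂ] 𝔥 :=
  ((k : ℂ) ^ 2) • H + ((k : ℂ) * (v : ℂ)) • H' + (((v : ℂ) ^ 2) / 2) • H''
    + ((k : ℂ) ^ 2) • RH (v / k)

/-- The truncated coupling `L̃_k = kL + vL'`. -/
noncomputable def lanLt (L L' : 𝔥 →L[ℂ] 𝔥) (v : ℝ) (k : ℕ) : 𝔥 →L[ℂ] 𝔥 :=
  (k : ℂ) • L + (v : ℂ) • L'

/-- The truncated Hamiltonian `H̃_k = k²H + kvH' + (v²/2)H'' + (v²/2)·Im{(L'')* L}`. -/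
noncomputable def lanHt (L L'' H H' H'' : 𝔥 →L[ℂ] 𝔥) (v : ℝ) (k : ℕ) : 𝔥 →L[ℂ] 𝔥 :=
  ((k : ℂ) ^ 2) • H + ((k : ℂ) * (v : ℂ)) • H' + (((v : ℂ) ^ 2) / 2) • H''
    + (((v : ℂ) ^ 2) / 2) • opIm (star L'' * L)

theorem opIm_neg_star_mul_self_add (A B : 𝔥 →L[ℂ] 𝔥) :
    opIm (-(star A * A) + B) = opIm B := by
  simp only [opIm, star_add, star_neg, star_mul, star_star]
  congr 1
  abel

theorem opIm_sub (A B : 𝔥 →L[ℂ] 𝔥) : opIm (A - B) = opIm A - opIm B := by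
  simp only [opIm, star_sub, ← smul_sub]
  congr 1
  abel

theorem opIm_smul_of_star_eq {c : ℂ} (hc : star c = c) (A : 𝔥 →L[ℂ] 𝔥) :
    opIm (c • A) = c • opIm A := by
  simp only [opIm, star_smul, hc, ← smul_sub]
  exact smul_comm _ _ _

theorem continuous_opIm : Continuous (opIm : (𝔥 →L[ℂ] 𝔥) → 𝔥 →L[ℂ] 𝔥) := by
  unfold opIm
  fun_prop

/-- A remainder that is `o(x²)` at `0` still vanishes after the rescaling `k² R(v/k)`. -/
theorem tendsto_sq_smul_of_isLittleO {E : Type*} [NormedAddCommGroup E] [NormedSpace ℂ E]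
    {R : ℝ → E} (hR : R =o[𝓝 (0 : ℝ)] fun x => x ^ 2) (v : ℝ) :
    Tendsto (fun k : ℕ => ((k : ℂ) ^ 2) • R (v / k)) atTop (𝓝 0) := by
  have hv : Tendsto (fun k : ℕ => v / (k : ℝ)) atTop (𝓝 0) :=
    tendsto_const_div_atTop_nhds_zero_nat v
  have h₁ : (fun k : ℕ => ((k : ℂ) ^ 2) • R (v / k)) =o[atTop]
      fun k : ℕ => ((k : ℝ) ^ 2) • (v / (k : ℝ)) ^ 2 := by
    refine IsBigO.smul_isLittleO (IsBigO.of_bound 1 (Eventually.of_forall fun k => ?_))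
      (hR.comp_tendsto hv)
    simp
  have h₂ : (fun k : ℕ => ((k : ℝ) ^ 2) • (v / (k : ℝ)) ^ 2) =O[atTop] fun _ => (1 : ℝ) := by
    refine IsBigO.of_bound (v ^ 2) ?_
    filter_upwards [eventually_ne_atTop 0] with k hk
    have hk' : (k : ℝ) ≠ 0 := Nat.cast_ne_zero.mpr hk
    have : ((k : ℝ) ^ 2) • (v / (k : ℝ)) ^ 2 = v ^ 2 := by
      rw [smul_eq_mul]
      field_simp
    rw [this]
    simp
  exact (isLittleO_one_iff ℝ).mp (h₁.trans_isBigO h₂)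

theorem lanLt_sub_lanL (L L' L'' : 𝔥 →L[ℂ] 𝔥) (RL : ℝ → 𝔥 →L[ℂ] 𝔥) (v : ℝ) (k : ℕ) :
    lanLt L L' v k - lanL L L' L'' RL v k =
      -(((v : ℂ) ^ 2) / (2 * (k : ℂ))) • L'' - (k : ℂ) • RL (v / k) := by
  simp only [lanLt, lanL, neg_smul]
  abel

/-- `(−L_k)* L̃_k` splits into `−(L̃_k)* L̃_k`, a vanishing term, and the constant
`−(v²/2) (L'')* L`. -/
theorem star_neg_lanL_mul_lanLt (L L' L'' : 𝔥 →L[ℂ] 𝔥) (RL : ℝ → 𝔥 →L[ℂ] 𝔥) (v : ℝ) {k : ℕ}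
    (hk : k ≠ 0) :
    star (-(lanL L L' L'' RL v k)) * lanLt L L' v k =
      -(star (lanLt L L' v k) * lanLt L L' v k) +
        (-((k : ℂ)⁻¹ • ((v : ℂ) ^ 3 / 2) • (star L'' * L')
            + star (((k : ℂ) ^ 2) • RL (v / k)) * (L + (k : ℂ)⁻¹ • (v : ℂ) • L'))
          - ((v : ℂ) ^ 2 / 2) • (star L'' * L)) := by
  have hk' : (k : ℂ) ≠ 0 := Nat.cast_ne_zero.mpr hk
  have hL : lanL L L' L'' RL v k = lanLt L L' v k +
      ((((v : ℂ) ^ 2) / (2 * (k : ℂ))) • L'' + (k : ℂ) • RL (v / k)) := by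
    simp only [lanL, lanLt]
    abel
  rw [hL, neg_add, star_add, add_mul, star_neg, neg_mul]
  congr 1
  simp only [lanLt, star_neg, star_add, star_smul, neg_mul, add_mul, mul_add, smul_mul_assoc,
    mul_smul_comm, smul_smul, RCLike.star_def, map_div₀, map_mul, map_pow, map_natCast,
    Complex.conj_ofReal, map_ofNat]
  match_scalars <;> field_simp

/-- Local asymptotic normality: the perturbation `δG_k = (G_k)⁻¹ ◁ G̃_k` (computed with the
multiplicity-one series product, inverse `G⁻¹ = (S*, −S*L, −H)`) has scattering component `I`,
coupling component `L̃_k − L_k = −(v²/(2k))L'' − k·R_L(v/k)`, and Hamiltonian component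
`H̃_k − H_k + Im{(−L_k)* L̃_k}`, the latter two converging to `0` in operator norm. -/
theorem lan_perturbation_vanishes
    (L L' L'' H H' H'' : 𝔥 →L[ℂ] 𝔥)
    (hH : IsSelfAdjoint H) (hH' : IsSelfAdjoint H') (hH'' : IsSelfAdjoint H'')
    (v : ℝ) (RL RH : ℝ → 𝔥 →L[ℂ] 𝔥)
    (hRHsa : ∀ x, IsSelfAdjoint (RH x))
    (hRL : RL =o[𝓝 (0 : ℝ)] fun x => x ^ 2)
    (hRH : RH =o[𝓝 (0 : ℝ)] fun x => x ^ 2) :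
    star (1 : 𝔥 →L[ℂ] 𝔥) * 1 = 1 ∧
    (∀ k : ℕ, lanLt L L' v k - lanL L L' L'' RL v k =
      -(((v : ℂ) ^ 2) / (2 * (k : ℂ))) • L'' - (k : ℂ) • RL (v / k)) ∧
    Tendsto (fun k : ℕ => ‖lanLt L L' v k - lanL L L' L'' RL v k‖) atTop (𝓝 0) ∧
    Tendsto
      (fun k : ℕ =>
        ‖lanHt L L'' H H' H'' v k - lanH H H' H'' RH v k
            + opIm (star (-(lanL L L' L'' RL v k)) * lanLt L L' v k)‖)
      atTop (𝓝 0) := by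
  have hinv : Tendsto (fun k : ℕ => (k : ℂ)⁻¹) atTop (𝓝 0) :=
    tendsto_inv_atTop_nhds_zero_nat
  have hT := tendsto_sq_smul_of_isLittleO hRL v
  refine ⟨by simp, lanLt_sub_lanL L L' L'' RL v, ?_, ?_⟩
  · have h : Tendsto (fun k : ℕ => (k : ℂ)⁻¹ •
        (-(((v : ℂ) ^ 2 / 2) • L'') - ((k : ℂ) ^ 2) • RL (v / k))) atTop (𝓝 0) := by
      simpa using hinv.smul (tendsto_const_nhds.sub hT)
    refine (tendsto_zero_iff_norm_tendsto_zero.mp h).congr' ?_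
    filter_upwards [eventually_ne_atTop 0] with k hk
    have hk' : (k : ℂ) ≠ 0 := Nat.cast_ne_zero.mpr hk
    rw [lanLt_sub_lanL]
    congr 1
    match_scalars <;> field_simp
  · have hE : Tendsto (fun k : ℕ =>
        -((k : ℂ)⁻¹ • ((v : ℂ) ^ 3 / 2) • (star L'' * L')
          + star (((k : ℂ) ^ 2) • RL (v / k)) * (L + (k : ℂ)⁻¹ • (v : ℂ) • L')))
        atTop (𝓝 0) := by
      simpa using ((hinv.smul_const (((v : ℂ) ^ 3 / 2) • (star L'' * L'))).add
        (hT.star.mul (tendsto_const_nhds.add (hinv.smul_const ((v : ℂ) • L'))))).neg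
    have h := ((continuous_opIm.tendsto (0 : 𝔥 →L[ℂ] 𝔥)).comp hE).sub
      (tendsto_sq_smul_of_isLittleO hRH v)
    have h₀ : opIm (0 : 𝔥 →L[ℂ] 𝔥) - 0 = 0 := by simp [opIm]
    rw [h₀] at h
    refine (tendsto_zero_iff_norm_tendsto_zero.mp h).congr' ?_
    filter_upwards [eventually_ne_atTop 0] with k hk
    have hc : star ((v : ℂ) ^ 2 / 2) = (v : ℂ) ^ 2 / 2 := by simp
    rw [star_neg_lanL_mul_lanLt L L' L'' RL v hk, opIm_neg_star_mul_self_add, opIm_sub,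
      opIm_smul_of_star_eq hc, lanHt, lanH, Function.comp_apply]
    congr 1
    abel
end
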